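/- Let A, B ⊆ ℝ be compact sets, let θ ∈ (0,1), and let α, β > 0 with α + β = 1. Suppose there exist nonzero finite Borel measures μ supported on A and ν supported on B such that J_{α,θ}(μ) < ∞ and J_{β,1−θ}(ν) < ∞, where J_{s,θ}(μ) = ( ∫_ℝ |μ̂(ξ)|^{2/θ} |ξ|^{s/θ − 1} dξ )^{θ}. Then the difference set A − B = { a − b : a ∈ A, b ∈ B } has positive one-dimensional Lebesgue measure. -/

import Mathlib

open MeasureTheory Real
open scoped ENNReal

/-- The Fourier transform `μ̂(ξ) = ∫ e^{-2πiξx} dμ(x)` of a measure on `ℝ`. -/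
noncomputable def measureFourier (μ : Measure ℝ) (ξ : ℝ) : ℂ :=
  ∫ x, Complex.exp (-(2 * π * ξ * x) * Complex.I) ∂μ

/-- The `(s,θ)`-energy `J_{s,θ}(μ) = (∫ |μ̂(ξ)|^{2/θ} |ξ|^{s/θ-1} dξ)^θ`. -/
noncomputable def energyJ (μ : Measure ℝ) (s θ : ℝ) : ℝ≥0∞ :=
  (∫⁻ ξ : ℝ, ENNReal.ofReal (‖measureFourier μ ξ‖ ^ (2 / θ) * |ξ| ^ (s / θ - 1))) ^ θ

open scoped FourierTransform SchwartzMap ContDiff Manifold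

lemma measureFourier_eq_fourierIntegral (ρ : Measure ℝ) :
    measureFourier ρ = VectorFourier.fourierIntegral 𝐞 ρ (innerₗ ℝ) (fun _ ↦ (1 : ℂ)) := by
  ext ξ
  simp only [measureFourier, VectorFourier.fourierIntegral, innerₗ_apply_apply, Circle.smul_def,
    Real.fourierChar_apply, smul_eq_mul, mul_one]
  congr 1 with x
  congr 1
  simp
  ring

lemma continuous_measureFourier (ρ : Measure ℝ) [IsFiniteMeasure ρ] :
    Continuous (measureFourier ρ) := by
  rw [measureFourier_eq_fourierIntegral]
  exact VectorFourier.fourierIntegral_continuous Real.continuous_fourierChar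
    continuous_inner (integrable_const _)

/-- Parseval's identity between a finite measure and a Schwartz function. -/
lemma integral_measureFourier_mul (ρ : Measure ℝ) [IsFiniteMeasure ρ] (g : 𝓢(ℝ, ℂ)) :
    ∫ ξ, measureFourier ρ ξ * g ξ = ∫ x, (𝓕 g) x ∂ρ := by
  rw [measureFourier_eq_fourierIntegral]
  have h := VectorFourier.integral_fourierIntegral_smul_eq_flip (μ := ρ) (ν := volume)
    (L := innerₗ ℝ) (f := fun _ ↦ (1 : ℂ)) (g := g) Real.continuous_fourierChar
    continuous_inner (integrable_const _) g.integrable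
  rw [flip_innerₗ] at h
  simp only [smul_eq_mul, one_mul] at h
  exact h

lemma eLpNorm_fourier_two (f : 𝓢(ℝ, ℂ)) :
    eLpNorm (𝓕 f : 𝓢(ℝ, ℂ)) 2 volume = eLpNorm f 2 volume := by
  have h := SchwartzMap.norm_fourier_toL2_eq f
  rw [SchwartzMap.norm_toLp, SchwartzMap.norm_toLp] at h
  exact (ENNReal.toReal_eq_toReal_iff' ((𝓕 f).memLp 2 volume).eLpNorm_ne_top
    (f.memLp 2 volume).eLpNorm_ne_top).1 h

lemma enorm_integral_le_eLpNorm_measureFourier_mul (ρ : Measure ℝ) [IsFiniteMeasure ρ]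
    (f : 𝓢(ℝ, ℂ)) :
    ‖∫ x, f x ∂ρ‖ₑ ≤ eLpNorm (measureFourier ρ) 2 volume * eLpNorm f 2 volume := by
  obtain ⟨g, rfl⟩ : ∃ g : 𝓢(ℝ, ℂ), 𝓕 g = f := ⟨𝓕⁻ f, FourierTransform.fourier_fourierInv_eq f⟩
  rw [eLpNorm_fourier_two, ← integral_measureFourier_mul]
  calc ‖∫ ξ, measureFourier ρ ξ * g ξ‖ₑ
      ≤ eLpNorm (measureFourier ρ • ⇑g) 1 volume := by
        rw [eLpNorm_one_eq_lintegral_enorm]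
        exact enorm_integral_le_lintegral_enorm _
    _ ≤ _ := eLpNorm_smul_le_mul_eLpNorm (p := 2) (q := 2) (r := 1)
        g.continuous.aestronglyMeasurable (continuous_measureFourier ρ).aestronglyMeasurable

lemma measure_le_of_isCompact_subset_isOpen (ρ : Measure ℝ) [IsFiniteMeasure ρ] {K U : Set ℝ}
    (hK : IsCompact K) (hU : IsOpen U) (hKU : K ⊆ U) :
    ρ K ≤ eLpNorm (measureFourier ρ) 2 volume * volume U ^ (1 / 2 : ℝ) := by
  obtain ⟨L, hL, hKL, hLU⟩ := exists_compact_between hK hU hKU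
  obtain ⟨f, hf1, hf0, hf⟩ := exists_contMDiffMap_one_nhds_of_subset_interior (n := (⊤ : ℕ∞)) 𝓘(ℝ, ℝ)
    hK.isClosed hKL
  have hsupp : HasCompactSupport (fun x ↦ (f x : ℂ)) :=
    HasCompactSupport.intro hL fun x hx ↦ by simp [hf0 x hx]
  have hsm : ContDiff ℝ ∞ (fun x ↦ (f x : ℂ)) :=
    Complex.ofRealCLM.contDiff.comp f.contMDiff.contDiff
  have hmain := enorm_integral_le_eLpNorm_measureFourier_mul ρ (hsupp.toSchwartzMap hsm)
  have hcoe : ⇑(hsupp.toSchwartzMap hsm) = fun x ↦ (f x : ℂ) := rfl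
  rw [hcoe, integral_complex_ofReal] at hmain
  have hint : Integrable f ρ :=
    f.contMDiff.continuous.integrable_of_hasCompactSupport
      (HasCompactSupport.intro hL fun x hx ↦ hf0 x hx)
  calc ρ K = ∫⁻ x, K.indicator 1 x ∂ρ := by simp [lintegral_indicator_one hK.measurableSet]
    _ ≤ ∫⁻ x, ENNReal.ofReal (f x) ∂ρ := by
        refine lintegral_mono fun x ↦ ?_
        by_cases hx : x ∈ K
        · have h1 : f x = 1 := hf1.self_of_nhdsSet x hx
          simp [hx, h1]
        · simp [hx]
    _ = ENNReal.ofReal (∫ x, f x ∂ρ) :=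
        (ofReal_integral_eq_lintegral_ofReal hint (ae_of_all _ fun x ↦ (hf x).1)).symm
    _ ≤ ‖((∫ x, f x ∂ρ : ℝ) : ℂ)‖ₑ := by
        rw [← ofReal_norm, Complex.norm_real]
        exact ENNReal.ofReal_le_ofReal (le_abs_self _)
    _ ≤ _ := hmain
    _ ≤ _ := by
        gcongr
        calc eLpNorm (fun x ↦ (f x : ℂ)) 2 volume
            ≤ eLpNorm (U.indicator fun _ ↦ (1 : ℝ)) 2 volume := by
              refine eLpNorm_mono fun x ↦ ?_
              by_cases hx : x ∈ L
              · simpa [hLU hx, abs_of_nonneg (hf x).1] using (hf x).2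
              · simp [hf0 x hx]
          _ ≤ ‖(1 : ℝ)‖ₑ * volume U ^ (1 / (2 : ℝ≥0∞).toReal) := eLpNorm_indicator_const_le _ _
          _ = _ := by simp

/-- A finite measure with square-integrable Fourier transform satisfies
`ρ K ≤ ‖ρ̂‖₂ |K|^{1/2}` on compact sets. -/
lemma measure_le_eLpNorm_measureFourier_mul (ρ : Measure ℝ) [IsFiniteMeasure ρ] {K : Set ℝ}
    (hK : IsCompact K) (hρ : eLpNorm (measureFourier ρ) 2 volume ≠ ⊤) :
    ρ K ≤ eLpNorm (measureFourier ρ) 2 volume * volume K ^ (1 / 2 : ℝ) := by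
  have hlim : Filter.Tendsto
      (fun ε : ℝ≥0∞ ↦ eLpNorm (measureFourier ρ) 2 volume * (volume K + ε) ^ (1 / 2 : ℝ))
      (nhdsWithin 0 (Set.Ioi 0))
      (nhds (eLpNorm (measureFourier ρ) 2 volume * (volume K + 0) ^ (1 / 2 : ℝ))) := by
    refine ENNReal.Tendsto.const_mul ?_ (Or.inr hρ)
    refine (ENNReal.continuous_rpow_const.tendsto _).comp ?_
    exact (tendsto_const_nhds.add Filter.tendsto_id).mono_left nhdsWithin_le_nhds
  rw [add_zero] at hlim
  refine ge_of_tendsto hlim (eventually_nhdsWithin_of_forall fun ε hε ↦ ?_)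
  obtain ⟨U, hKU, hU, hle⟩ := K.exists_isOpen_le_add volume (ne_of_gt hε)
  exact (measure_le_of_isCompact_subset_isOpen ρ hK hU hKU).trans (by gcongr)

lemma measureFourier_map_sub_prod (μ ν : Measure ℝ) [IsFiniteMeasure μ] [IsFiniteMeasure ν]
    (ξ : ℝ) :
    measureFourier ((μ.prod ν).map fun p ↦ p.1 - p.2) ξ =
      measureFourier μ ξ * starRingEnd ℂ (measureFourier ν ξ) := by
  unfold measureFourier
  rw [integral_map (by fun_prop) (by fun_prop), ← integral_conj, ← integral_prod_mul]
  congr 1 with p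
  rw [← Complex.exp_conj, ← Complex.exp_add]
  congr 1
  simp [Complex.conj_ofNat]
  ring

lemma lintegral_rpow_lt_top_of_energyJ {μ : Measure ℝ} {s θ : ℝ} (hθ : 0 < θ)
    (h : energyJ μ s θ < ⊤) :
    ∫⁻ ξ, ENNReal.ofReal (‖measureFourier μ ξ‖ ^ 2 * |ξ| ^ (s - θ)) ^ (1 / θ) < ⊤ := by
  rw [energyJ, ENNReal.rpow_lt_top_iff_of_pos hθ] at h
  convert h using 3 with ξ
  rw [ENNReal.ofReal_rpow_of_nonneg (by positivity) (by positivity),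
    Real.mul_rpow (by positivity) (by positivity), ← Real.rpow_natCast,
    ← Real.rpow_mul (by positivity),
    ← Real.rpow_mul (by positivity)]
  congr 3
  · push_cast; ring
  · field_simp

lemma lintegral_norm_sq_mul_lt_top {μ ν : Measure ℝ} [IsFiniteMeasure μ] [IsFiniteMeasure ν]
    {θ α β : ℝ} (hθ : θ ∈ Set.Ioo (0 : ℝ) 1) (hαβ : α + β = 1)
    (hμE : energyJ μ α θ < ⊤) (hνE : energyJ ν β (1 - θ) < ⊤) :
    ∫⁻ ξ, ENNReal.ofReal ((‖measureFourier μ ξ‖ * ‖measureFourier ν ξ‖) ^ 2) < ⊤ := by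
  obtain ⟨h0, h1⟩ := hθ
  have h1' : 0 < 1 - θ := by linarith
  have hpq : (1 / θ).HolderConjugate (1 / (1 - θ)) := by
    rw [Real.holderConjugate_iff]
    exact ⟨by rw [lt_div_iff₀ h0]; linarith, by simp⟩
  have hmμ := (continuous_measureFourier μ).measurable
  have hmν := (continuous_measureFourier ν).measurable
  have hH := ENNReal.lintegral_mul_le_Lp_mul_Lq volume hpq
    (f := fun ξ ↦ ENNReal.ofReal (‖measureFourier μ ξ‖ ^ 2 * |ξ| ^ (α - θ)))
    (g := fun ξ ↦ ENNReal.ofReal (‖measureFourier ν ξ‖ ^ 2 * |ξ| ^ (β - (1 - θ))))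
    (by fun_prop) (by fun_prop)
  refine lt_of_eq_of_lt (lintegral_congr_ae ?_) (hH.trans_lt (ENNReal.mul_lt_top
    (ENNReal.rpow_lt_top_of_nonneg (by positivity) (lintegral_rpow_lt_top_of_energyJ h0 hμE).ne)
    (ENNReal.rpow_lt_top_of_nonneg (by positivity) (lintegral_rpow_lt_top_of_energyJ h1' hνE).ne)))
  filter_upwards [Measure.ae_ne volume (0 : ℝ)] with ξ hξ
  rw [Pi.mul_apply, ← ENNReal.ofReal_mul (by positivity)]
  congr 1
  have hpow : |ξ| ^ (α - θ) * |ξ| ^ (β - (1 - θ)) = 1 := by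
    rw [← Real.rpow_add (abs_pos.2 hξ), show α - θ + (β - (1 - θ)) = 0 by linarith, Real.rpow_zero]
  linear_combination -(‖measureFourier μ ξ‖ * ‖measureFourier ν ξ‖) ^ 2 * hpow

/-- STATEMENT 16: if compact `A, B ⊆ ℝ` carry nonzero finite measures `μ, ν` with
`J_{α,θ}(μ) < ∞` and `J_{β,1-θ}(ν) < ∞`, where `θ ∈ (0,1)`, `α, β > 0`, `α + β = 1`,
then the difference set `A - B` has positive Lebesgue measure. -/
theorem stmt_17 (A B : Set ℝ) (hA : IsCompact A) (hB : IsCompact B)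
    (θ α β : ℝ) (hθ : θ ∈ Set.Ioo (0 : ℝ) 1) (hα : 0 < α) (hβ : 0 < β)
    (hαβ : α + β = 1)
    (μ ν : Measure ℝ) [IsFiniteMeasure μ] [IsFiniteMeasure ν]
    (hμ : μ ≠ 0) (hν : ν ≠ 0) (hμsupp : μ Aᶜ = 0) (hνsupp : ν Bᶜ = 0)
    (hμE : energyJ μ α θ < ⊤) (hνE : energyJ ν β (1 - θ) < ⊤) :
    0 < volume {d : ℝ | ∃ a ∈ A, ∃ b ∈ B, a - b = d} := by
  set ρ := (μ.prod ν).map fun p ↦ p.1 - p.2 with hρ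
  have hL2 : eLpNorm (measureFourier ρ) 2 volume ≠ ⊤ := by
    rw [eLpNorm_eq_lintegral_rpow_enorm_toReal two_ne_zero ENNReal.ofNat_ne_top]
    refine ENNReal.rpow_ne_top_of_nonneg (by positivity) ?_
    convert (lintegral_norm_sq_mul_lt_top hθ hαβ hμE hνE).ne using 3 with ξ
    rw [hρ, measureFourier_map_sub_prod, ENNReal.ofReal_pow (by positivity),
      ENNReal.ofReal_mul (by positivity)]
    simp [enorm_mul]
  have hK : IsCompact {d : ℝ | ∃ a ∈ A, ∃ b ∈ B, a - b = d} := by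
    convert (hA.prod hB).image (f := fun p : ℝ × ℝ ↦ p.1 - p.2) (by fun_prop) using 1
    ext d
    constructor
    · rintro ⟨a, ha, b, hb, rfl⟩
      exact ⟨(a, b), ⟨ha, hb⟩, rfl⟩
    · rintro ⟨⟨a, b⟩, ⟨ha, hb⟩, rfl⟩
      exact ⟨a, ha, b, hb, rfl⟩
  rw [pos_iff_ne_zero]
  intro h0
  have hle := measure_le_eLpNorm_measureFourier_mul ρ hK hL2
  rw [h0, ENNReal.zero_rpow_of_pos (by norm_num), mul_zero, hρ,
    Measure.map_apply (by fun_prop) hK.measurableSet] at hle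
  have hAB : μ A * ν B ≤ 0 := by
    rw [← Measure.prod_prod]
    refine (measure_mono ?_).trans hle
    rintro ⟨a, b⟩ ⟨ha, hb⟩
    exact ⟨a, ha, b, hb, rfl⟩
  rcases mul_eq_zero.1 (nonpos_iff_eq_zero.1 hAB) with h | h
  · exact hμ (Measure.measure_univ_eq_zero.1 (Set.union_compl_self A ▸ measure_union_null h hμsupp))
  · exact hν (Measure.measure_univ_eq_zero.1 (Set.union_compl_self B ▸ measure_union_null h hνsupp))
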